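/- Let (M, ⊵, Emb) be a target for a prefactor system with embeddings (M_I, ⊵, emb). Define a ∼_i b iff there exist a_i, b_i ∈ M_i with a ⊵ a_i, b ⊵ b_i and a_i ≍ b_i; set P_i := {Emb_i(a_i) : a_i ∈ M_i}; and define pt_i(a) := Emb_i(a_i) for any a_i ∈ M_i with a ⊵ a_i. Then pt_i is a well-defined surjective map from [i] := {a : a ∼_i a} onto P_i, and (M, ∼_I, pt_I) is a pointed 𝔉-set: (1) P_i ⊆ P_{i'} for i ≤ i'; (2) a ∼_i b implies a ∼_i pt_i(a) and pt_i(a) = pt_i(b); (3) a ∈ [i] ∩ [i'] with i ≤ i' implies pt_{i'}(a) ∈ [i]. Moreover, a_{i'} ⊵ a_i implies pt_i(Emb_{i'}(a_{i'})) = Emb_i(a_i) for i ≤ i'. -/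

import Mathlib

/-- A prefactor system over a directed preorder `I`: a family of sets `A i`
with relations `rel : A i' → A i → Prop` for `i ≤ i'`, reflexive at equal
stages, satisfying the (Factor) property: `a' ≍ a ↔ a' ⊵ a` for `i ≤ i'`. -/
structure PrefactorSystem (I : Type*) [Preorder I] where
  /-- the family of sets -/
  A : I → Type*
  /-- the predecessor relation `⊵` -/
  rel : ∀ ⦃i i' : I⦄, i ≤ i' → A i' → A i → Prop
  refl : ∀ (i : I) (h : i ≤ i) (a : A i), rel h a a
  /-- the (Factor) property, with consistency `≍` spelled out -/
  factor : ∀ ⦃i i' : I⦄ (h : i ≤ i') (a' : A i') (a : A i),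
    (∃ (k : I) (h1 : i' ≤ k) (h2 : i ≤ k) (c : A k), rel h1 c a' ∧ rel h2 c a) ↔ rel h a' a

/-- Consistency `a ≍ b` of two elements of a system. -/
def PrefactorSystem.Cons {I : Type*} [Preorder I] (S : PrefactorSystem I)
    {i j : I} (a : S.A i) (b : S.A j) : Prop :=
  ∃ (k : I) (h1 : i ≤ k) (h2 : j ≤ k) (c : S.A k), S.rel h1 c a ∧ S.rel h2 c b

/-- A target `(M, ⊵)` for a prefactor system. -/
structure Target {I : Type*} [Preorder I] (F : Set (Set I)) (S : PrefactorSystem I) where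
  /-- the carrier of the target -/
  M : Type*
  /-- the relation `a ⊵ a_i` between `M` and the stages -/
  R : ∀ i : I, M → S.A i → Prop
  /-- `I_a ∈ 𝔉(I)` for every `a ∈ M` -/
  dense : ∀ a : M, {i | ∃ x, R i a x} ∈ F
  /-- `a ⊵ a_{i'}` and `a ⊵ a_i` imply `a_{i'} ⊵ a_i` for `i ≤ i'` -/
  compat : ∀ ⦃i i' : I⦄ (h : i ≤ i') (a : M) (x' : S.A i') (x : S.A i),
    R i' a x' → R i a x → S.rel h x' x

/-- The induced family of relations `a ∼_i b` on a target. -/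
def Target.per {I : Type*} [Preorder I] {F : Set (Set I)} {S : PrefactorSystem I}
    (T : Target F S) (i : I) (a b : T.M) : Prop :=
  ∃ (x y : S.A i), T.R i a x ∧ T.R i b y ∧ S.Cons x y

/-- A prefactor system with (coherent) embeddings. -/
structure PrefactorSystemEmb (I : Type*) [Preorder I] extends PrefactorSystem I where
  /-- the embeddings `emb_{i,i'} : A i → A i'` for `i ≤ i'` -/
  emb : ∀ ⦃i i' : I⦄, i ≤ i' → A i → A i'
  /-- the embeddings preserve consistency -/
  emb_pres : ∀ ⦃i i' : I⦄ (h : i ≤ i') (a b : A i),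
    toPrefactorSystem.Cons a b → toPrefactorSystem.Cons (emb h a) (emb h b)
  /-- `emb_{i,i}(a) ≍ a` -/
  emb_self : ∀ (i : I) (h : i ≤ i) (a : A i), toPrefactorSystem.Cons (emb h a) a
  /-- `emb_{i',i''}(emb_{i,i'}(a)) ≍ emb_{i,i''}(a)` -/
  emb_comp : ∀ ⦃i i' i'' : I⦄ (h1 : i ≤ i') (h2 : i' ≤ i'') (a : A i),
    toPrefactorSystem.Cons (emb h2 (emb h1 a)) (emb (h1.trans h2) a)
  /-- the coherence property (Emb) -/
  emb_rel : ∀ ⦃i i' i'' : I⦄ (h : i ≤ i') (h2 : i' ≤ i'') (a' : A i') (a : A i),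
    rel h a' a → rel (h.trans h2) (emb h2 a') a

/-- A target `(M, ⊵, Emb)` for a prefactor system with embeddings. -/
structure TargetEmb {I : Type*} [Preorder I] (F : Set (Set I)) (S : PrefactorSystemEmb I) where
  /-- the carrier of the target -/
  M : Type*
  /-- the relation `a ⊵ a_i` between `M` and the stages -/
  R : ∀ i : I, M → S.A i → Prop
  /-- `I_a ∈ 𝔉(I)` for every `a ∈ M` -/
  dense : ∀ a : M, {i | ∃ x, R i a x} ∈ F
  /-- `a ⊵ a_{i'}` and `a ⊵ a_i` imply `a_{i'} ⊵ a_i` for `i ≤ i'` -/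
  compat : ∀ ⦃i i' : I⦄ (h : i ≤ i') (a : M) (x' : S.A i') (x : S.A i),
    R i' a x' → R i a x → S.rel h x' x
  /-- the maps `Emb_i : A i → M` -/
  Emb : ∀ i : I, S.A i → M
  /-- `Emb_i` preserves consistency (consistency on the target being equality) -/
  Emb_pres : ∀ (i : I) (a b : S.A i), S.toPrefactorSystem.Cons a b → Emb i a = Emb i b
  /-- `Emb_{i'}(emb_{i,i'}(a)) = Emb_i(a)` -/
  Emb_comm : ∀ ⦃i i' : I⦄ (h : i ≤ i') (a : S.A i), Emb i' (S.emb h a) = Emb i a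
  /-- `a' ⊵ a` implies `Emb_{i'}(a') ⊵ a` -/
  Emb_rel : ∀ ⦃i i' : I⦄ (h : i ≤ i') (a' : S.A i') (a : S.A i),
    S.rel h a' a → R i (Emb i' a') a

/-- The induced family of relations `a ∼_i b` on a target. -/
def TargetEmb.per {I : Type*} [Preorder I] {F : Set (Set I)} {S : PrefactorSystemEmb I}
    (T : TargetEmb F S) (i : I) (a b : T.M) : Prop :=
  ∃ (x y : S.A i), T.R i a x ∧ T.R i b y ∧ S.toPrefactorSystem.Cons x y

/-- The induced point maps `pt_i(a) := Emb_i(a_i)` for some `a_i` with `a ⊵ a_i`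
(junk value outside the domain `[i]`). -/
noncomputable def TargetEmb.pt {I : Type*} [Preorder I] {F : Set (Set I)}
    {S : PrefactorSystemEmb I} (T : TargetEmb F S) (i : I) (a : T.M) : T.M :=
  letI := Classical.propDecidable (∃ x, T.R i a x)
  if h : ∃ x, T.R i a x then T.Emb i h.choose else a

namespace PrefactorSystem

variable {I : Type*} [Preorder I] (S : PrefactorSystem I)

theorem cons_refl {i : I} (x : S.A i) : S.Cons x x :=
  ⟨i, le_rfl, le_rfl, x, S.refl i _ x, S.refl i _ x⟩

variable {S}

theorem Cons.symm {i j : I} {x : S.A i} {y : S.A j} (h : S.Cons x y) : S.Cons y x :=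
  let ⟨k, h1, h2, c, hx, hy⟩ := h
  ⟨k, h2, h1, c, hy, hx⟩

theorem Cons.rel {i j : I} {x : S.A j} {y : S.A i} (h : S.Cons x y) (hij : i ≤ j) :
    S.rel hij x y :=
  (S.factor hij x y).1 h

theorem cons_of_rel {i j : I} {hij : i ≤ j} {x : S.A j} {y : S.A i} (h : S.rel hij x y) :
    S.Cons x y :=
  (S.factor hij x y).2 h

theorem Cons.trans {i : I} {x y z : S.A i} (h₁ : S.Cons x y) (h₂ : S.Cons y z) : S.Cons x z :=
  ⟨i, le_rfl, le_rfl, y, h₁.symm.rel _, h₂.rel _⟩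

end PrefactorSystem

namespace TargetEmb

variable {I : Type*} [Preorder I] {F : Set (Set I)} {S : PrefactorSystemEmb I} (T : TargetEmb F S)

theorem cons_of_R {i : I} {a : T.M} {x y : S.A i} (hx : T.R i a x) (hy : T.R i a y) :
    S.toPrefactorSystem.Cons x y :=
  PrefactorSystem.cons_of_rel (T.compat le_rfl a x y hx hy)

theorem R_Emb {i : I} (x : S.A i) : T.R i (T.Emb i x) x :=
  T.Emb_rel le_rfl x x (S.refl i _ x)

theorem pt_eq {i : I} {a : T.M} {x : S.A i} (hx : T.R i a x) : T.pt i a = T.Emb i x := by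
  have h : ∃ x, T.R i a x := ⟨x, hx⟩
  rw [pt, dif_pos h]
  exact T.Emb_pres i _ _ (T.cons_of_R h.choose_spec hx)

theorem per_self_iff {i : I} {a : T.M} : T.per i a a ↔ ∃ x, T.R i a x :=
  ⟨fun ⟨x, _, hx, _⟩ => ⟨x, hx⟩, fun ⟨x, hx⟩ => ⟨x, x, hx, hx, PrefactorSystem.cons_refl _ x⟩⟩

end TargetEmb

/-- for a target `(M, ⊵, Emb)` of a prefactor system with
embeddings, with `a ∼_i b` defined via consistent approximations,
`P_i := Emb_i[A i]` (= `Set.range (T.Emb i)`) and `pt_i(a) := Emb_i(a_i)` for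
any `a_i` with `a ⊵ a_i`: `pt_i` is a well-defined surjective map from
`[i]` onto `P_i`, and `(M, ∼, pt)` is a pointed 𝔉-set (PERs, dense,
approximating, and the pointedness conditions (1)-(3)).  Moreover,
`a' ⊵ a` implies `pt_i(Emb_{i'}(a')) = Emb_i(a)` for `i ≤ i'`. -/
theorem stmt7 {I : Type*} [Preorder I] [Nonempty I] [IsDirected I (· ≤ ·)]
    {F : Set (Set I)} (hcof : ∀ H ∈ F, ∀ i : I, ∃ j ∈ H, i ≤ j)
    {S : PrefactorSystemEmb I} (T : TargetEmb F S) :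
    -- `pt_i` is well defined: its value is `Emb_i(x)` for *any* approximation `x` of `a`
    (∀ (i : I) (a : T.M) (x : S.A i), T.R i a x → T.pt i a = T.Emb i x) ∧
    -- `pt_i` maps `[i]` into `P_i`
    (∀ (i : I) (a : T.M), T.per i a a → T.pt i a ∈ Set.range (T.Emb i)) ∧
    -- `pt_i : [i] → P_i` is surjective
    (∀ i : I, ∀ p ∈ Set.range (T.Emb i), ∃ a : T.M, T.per i a a ∧ T.pt i a = p) ∧
    -- each `∼_i` is a partial equivalence relation
    (∀ (i : I) (a b : T.M), T.per i a b → T.per i b a) ∧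
    (∀ (i : I) (a b c : T.M), T.per i a b → T.per i b c → T.per i a c) ∧
    -- density
    (∀ a : T.M, {i | T.per i a a} ∈ F) ∧
    -- approximating
    (∀ ⦃i i' : I⦄, i ≤ i' → ∀ a b : T.M,
      T.per i' a b → T.per i a a → T.per i b b → T.per i a b) ∧
    -- (1) `P_i ⊆ P_{i'}` for `i ≤ i'`
    (∀ ⦃i i' : I⦄, i ≤ i' → Set.range (T.Emb i) ⊆ Set.range (T.Emb i')) ∧
    -- (2) `a ∼_i b` implies `a ∼_i pt_i(a)` and `pt_i(a) = pt_i(b)`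
    (∀ (i : I) (a b : T.M), T.per i a b → T.per i a (T.pt i a) ∧ T.pt i a = T.pt i b) ∧
    -- (3) `a ∈ [i] ∩ [i']` implies `pt_{i'}(a) ∈ [i]` for `i ≤ i'`
    (∀ ⦃i i' : I⦄, i ≤ i' → ∀ a : T.M, T.per i a a → T.per i' a a →
      T.per i (T.pt i' a) (T.pt i' a)) ∧
    -- moreover: `a' ⊵ a` implies `pt_i(Emb_{i'}(a')) = Emb_i(a)`
    (∀ ⦃i i' : I⦄ (h : i ≤ i') (a' : S.A i') (a : S.A i),
      S.rel h a' a → T.pt i (T.Emb i' a') = T.Emb i a) := by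
  refine ⟨fun i a x => T.pt_eq, ?_, ?_, ?_, ?_, ?_, ?_, ?_, ?_, ?_, ?_⟩
  · rintro i a ⟨x, _, hx, -⟩
    exact ⟨x, (T.pt_eq hx).symm⟩
  · rintro i _ ⟨x, rfl⟩
    exact ⟨T.Emb i x, T.per_self_iff.2 ⟨x, T.R_Emb x⟩, T.pt_eq (T.R_Emb x)⟩
  · rintro i a b ⟨x, y, hx, hy, h⟩
    exact ⟨y, x, hy, hx, h.symm⟩
  · rintro i a b c ⟨x, y, hx, hy, hxy⟩ ⟨y', z, hy', hz, hyz⟩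
    exact ⟨x, z, hx, hz, (hxy.trans (T.cons_of_R hy hy')).trans hyz⟩
  · intro a
    simpa only [T.per_self_iff] using T.dense a
  · rintro i i' h a b ⟨x', y', hx', hy', h'⟩ ⟨x, _, hx, -⟩ ⟨y, _, hy, -⟩
    refine ⟨x, y, hx, hy, T.cons_of_R (a := T.Emb i' x') ?_ ?_⟩
    · exact T.Emb_rel h _ _ (T.compat h a _ _ hx' hx)
    · rw [T.Emb_pres i' _ _ h']
      exact T.Emb_rel h _ _ (T.compat h b _ _ hy' hy)
  · rintro i i' h _ ⟨x, rfl⟩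
    exact ⟨S.emb h x, T.Emb_comm h x⟩
  · rintro i a b ⟨x, y, hx, hy, h⟩
    rw [T.pt_eq hx, T.pt_eq hy]
    exact ⟨⟨x, x, hx, T.R_Emb x, PrefactorSystem.cons_refl _ x⟩, T.Emb_pres i x y h⟩
  · rintro i i' h a ⟨x, _, hx, -⟩ ⟨x', _, hx', -⟩
    rw [T.pt_eq hx']
    exact T.per_self_iff.2 ⟨x, T.Emb_rel h _ _ (T.compat h a _ _ hx' hx)⟩
  · intro i i' h a' a ha
    exact T.pt_eq (T.Emb_rel h a' a ha)
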